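/- Let G be an undirected graph on N vertices, let k > N, and let P(G,k) be the vertex-cover DAG of G with parameter k. Then every valid pebbling of P(G,k) with R = k + 1 red pebbles in the oneshot model has cost at least 2·(k − N)·τ(G), where τ(G) denotes the minimum size of a vertex cover of G. -/

import Mathlib

namespace RBPebble

open scoped Classical

/-- A pebble is either red (fast memory) or blue (slow memory). -/
inductive Peb : Type
  | red
  | blue
  deriving DecidableEq

/-- The four kinds of moves of a red-blue pebbling. -/
inductive Move (V : Type) : Type
  | toRed (v : V)    -- (1) replace a blue pebble by a red pebble
  | toBlue (v : V)   -- (2) replace a red pebble by a blue pebble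
  | compute (v : V)  -- (3) place a red pebble on a node whose in-neighbors are all red
  | delete (v : V)   -- (4) delete a pebble
  deriving DecidableEq

variable {V : Type}

/-- A configuration assigns to each node no pebble, a red pebble, or a blue pebble. -/
def Config (V : Type) : Type := V → Option Peb

/-- The initial configuration: no pebbles anywhere. -/
def initConfig : Config V := fun _ => none

/-- The effect of a move on a configuration. -/
def applyMove [DecidableEq V] (c : Config V) : Move V → Config V
  | .toRed v => Function.update c v (some Peb.red)
  | .toBlue v => Function.update c v (some Peb.blue)
  | .compute v => Function.update c v (some Peb.red)
  | .delete v => Function.update c v none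

/-- The number of red pebbles in a configuration. -/
noncomputable def redCount [Fintype V] (c : Config V) : ℕ :=
  (Finset.univ.filter fun v => c v = some Peb.red).card

/-- Legality of a move in a given configuration (base model). -/
def legalMove (edge : V → V → Prop) (c : Config V) : Move V → Prop
  | .toRed v => c v = some Peb.blue
  | .toBlue v => c v = some Peb.red
  | .compute v => ∀ u, edge u v → c u = some Peb.red
  | .delete v => c v ≠ none

/-- A sequence of moves is valid from a configuration: every move is legal and
at every point at most `R` red pebbles are on the graph. -/
def ValidFrom [Fintype V] [DecidableEq V] (edge : V → V → Prop) (R : ℕ) :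
    Config V → List (Move V) → Prop
  | _, [] => True
  | c, m :: ms =>
      legalMove edge c m ∧ redCount (applyMove c m) ≤ R ∧
        ValidFrom edge R (applyMove c m) ms

/-- Running a list of moves from a configuration. -/
def runMoves [DecidableEq V] (c : Config V) : List (Move V) → Config V
  | [] => c
  | m :: ms => runMoves (applyMove c m) ms

/-- A sink: a node with no outgoing edge. -/
def IsSink (edge : V → V → Prop) (v : V) : Prop := ∀ u, ¬ edge v u

/-- A source: a node with no incoming edge. -/
def IsSource (edge : V → V → Prop) (v : V) : Prop := ∀ u, ¬ edge u v

/-- A valid pebbling of the DAG with `R` red pebbles: starts from the empty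
configuration, is valid throughout, and in the final configuration every sink
carries a pebble (of either color). -/
def IsPebbling [Fintype V] [DecidableEq V] (edge : V → V → Prop) (R : ℕ)
    (moves : List (Move V)) : Prop :=
  ValidFrom edge R initConfig moves ∧
    ∀ v, IsSink edge v → runMoves initConfig moves v ≠ none

def isTransfer : Move V → Bool
  | .toRed _ => true
  | .toBlue _ => true
  | _ => false

def isCompute : Move V → Bool
  | .compute _ => true
  | _ => false

def isDelete : Move V → Bool
  | .delete _ => true
  | _ => false

/-- The cost of a pebbling: the number of moves of types (1) and (2). -/
def cost (moves : List (Move V)) : ℕ := (moves.filter isTransfer).length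

/-- The number of compute moves (type (3)). -/
def computeCount (moves : List (Move V)) : ℕ := (moves.filter isCompute).length

/-- The number of delete moves (type (4)). -/
def deleteCount (moves : List (Move V)) : ℕ := (moves.filter isDelete).length

/-- The cost in the compcost model: transfers plus `ε` times the computes. -/
noncomputable def ccCost (ε : ℝ) (moves : List (Move V)) : ℝ :=
  (cost moves : ℝ) + ε * (computeCount moves : ℝ)

/-- The oneshot restriction: each node is computed at most once. -/
def Oneshot [DecidableEq V] (moves : List (Move V)) : Prop :=
  ∀ v : V, moves.count (Move.compute v) ≤ 1

/-- The nodel restriction: no delete moves are used. -/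
def NoDel (moves : List (Move V)) : Prop := ∀ m ∈ moves, isDelete m = false

/-- The indegree of a node. -/
noncomputable def indeg [Fintype V] (edge : V → V → Prop) (v : V) : ℕ :=
  (Finset.univ.filter fun u => edge u v).card

/-- The edge relation is acyclic (the graph is a DAG). -/
def Acyclic (edge : V → V → Prop) : Prop :=
  ∀ v, ¬ Relation.TransGen edge v v

/-- The optimal cost of a valid pebbling with `R` red pebbles in the oneshot model. -/
noncomputable def optCost [Fintype V] [DecidableEq V] (edge : V → V → Prop) (R : ℕ) : ℕ :=
  sInf {c | ∃ moves : List (Move V),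
    IsPebbling edge R moves ∧ Oneshot moves ∧ cost moves = c}

/-- The node type of the vertex-cover DAG `P(G,k)` of an undirected graph
`G = (Fin N, adj)` with parameter `k > N`. The five summands are, in order:
the common source nodes (`C_a` has the `k − N` nodes `(a, j)`); the first-level
target nodes `t_{a,1,b}` (pairs `(a, b)` with `b ≠ a`); the second-level target
nodes `t_{a,2}`; the `N` fresh filler source nodes of each first-level group
`V_{a,1}`; and the `N − deg(a)` fresh filler source nodes of each second-level
group `V_{a,2}` (pairs `(a, b)` with `b` not adjacent to `a`). -/
abbrev VCNode (N k : ℕ) (adj : Fin N → Fin N → Prop) : Type :=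
  (Fin N × Fin (k - N)) ⊕
    ({p : Fin N × Fin N // p.1 ≠ p.2} ⊕
      (Fin N ⊕
        ((Fin N × Fin N) ⊕ {p : Fin N × Fin N // ¬ adj p.1 p.2})))

/-- Membership in the first-level input group `V_{a,1}`: the `k − N` common
nodes of `a` together with the `N` first-level fillers of `a` (a set of size
`k`). -/
def inGroup1 {N k : ℕ} {adj : Fin N → Fin N → Prop} (a : Fin N) :
    VCNode N k adj → Prop
  | Sum.inl q => q.1 = a
  | Sum.inr (Sum.inr (Sum.inr (Sum.inl q))) => q.1 = a
  | _ => False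

/-- Membership in the second-level input group `V_{a,2}`: the `k − N` common
nodes of `a`, the first-level targets `t_{b,1,a}` for every edge `{a,b}` of
`G`, and the second-level fillers of `a` (a set of size `k`). -/
def inGroup2 {N k : ℕ} {adj : Fin N → Fin N → Prop} (a : Fin N) :
    VCNode N k adj → Prop
  | Sum.inl q => q.1 = a
  | Sum.inr (Sum.inl p) => p.val.2 = a ∧ adj a p.val.1
  | Sum.inr (Sum.inr (Sum.inr (Sum.inr p))) => p.val.1 = a
  | _ => False

/-- The edge relation of `P(G,k)`: the in-neighbor set of each first-level
target `t_{a,1,b}` is exactly `V_{a,1}`, and the in-neighbor set of each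
second-level target `t_{a,2}` is exactly `V_{a,2}`. -/
def vcEdge (N k : ℕ) (adj : Fin N → Fin N → Prop) :
    VCNode N k adj → VCNode N k adj → Prop := fun u v =>
  match v with
  | Sum.inr (Sum.inl p) => inGroup1 p.val.1 u
  | Sum.inr (Sum.inr (Sum.inl a)) => inGroup2 a u
  | _ => False

/-- A vertex cover of `G`: a set of vertices meeting every edge. -/
def IsVertexCover {N : ℕ} (adj : Fin N → Fin N → Prop)
    (S : Finset (Fin N)) : Prop :=
  ∀ a b, adj a b → a ∈ S ∨ b ∈ S

/-- `τ(G)`: the minimum size of a vertex cover of `G`. -/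
noncomputable def vcNumber {N : ℕ} (adj : Fin N → Fin N → Prop) : ℕ :=
  sInf {m | ∃ S : Finset (Fin N), IsVertexCover adj S ∧ S.card = m}

section Runs

variable [DecidableEq V]

theorem applyMove_toRed (c : Config V) (w v : V) :
    applyMove c (Move.toRed w) v = if v = w then some Peb.red else c v :=
  Function.update_apply c w _ v

theorem applyMove_toBlue (c : Config V) (w v : V) :
    applyMove c (Move.toBlue w) v = if v = w then some Peb.blue else c v :=
  Function.update_apply c w _ v

theorem applyMove_compute (c : Config V) (w v : V) :
    applyMove c (Move.compute w) v = if v = w then some Peb.red else c v :=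
  Function.update_apply c w _ v

theorem applyMove_delete (c : Config V) (w v : V) :
    applyMove c (Move.delete w) v = if v = w then none else c v :=
  Function.update_apply c w _ v

theorem runMoves_append (c : Config V) (l₁ l₂ : List (Move V)) :
    runMoves c (l₁ ++ l₂) = runMoves (runMoves c l₁) l₂ := by
  induction l₁ generalizing c with
  | nil => rfl
  | cons m ms ih => exact ih _

theorem validFrom_append [Fintype V] {edge : V → V → Prop} {R : ℕ} (c : Config V)
    (l₁ l₂ : List (Move V)) :
    ValidFrom edge R c (l₁ ++ l₂) ↔
      ValidFrom edge R c l₁ ∧ ValidFrom edge R (runMoves c l₁) l₂ := by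
  induction l₁ generalizing c with
  | nil => simp [ValidFrom, runMoves]
  | cons m ms ih => simp [ValidFrom, runMoves, ih, and_assoc]

/-- An empty node stays empty as long as it is not computed. -/
theorem runMoves_eq_none [Fintype V] {edge : V → V → Prop} {R : ℕ} {v : V}
    {l : List (Move V)} {c : Config V} (hl : ValidFrom edge R c l) (hc : c v = none)
    (hv : Move.compute v ∉ l) : runMoves c l v = none := by
  induction l generalizing c with
  | nil => exact hc
  | cons m ms ih =>
    obtain ⟨hm, -, hms⟩ := hl
    refine ih hms ?_ (fun h => hv (List.mem_cons_of_mem _ h))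
    cases m with
    | toRed w =>
      have : v ≠ w := by rintro rfl; simp [legalMove, hc] at hm
      simp [applyMove_toRed, this, hc]
    | toBlue w =>
      have : v ≠ w := by rintro rfl; simp [legalMove, hc] at hm
      simp [applyMove_toBlue, this, hc]
    | compute w =>
      have : v ≠ w := by rintro rfl; simp at hv
      simp [applyMove_compute, this, hc]
    | delete w => simp [applyMove_delete, hc]

/-- A node that turns blue is the subject of a red-to-blue transfer. -/
theorem toBlue_mem_of_runMoves_eq_blue {v : V} {l : List (Move V)} {c : Config V}
    (hc : c v ≠ some Peb.blue) (hv : runMoves c l v = some Peb.blue) :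
    Move.toBlue v ∈ l := by
  induction l generalizing c with
  | nil => exact absurd hv hc
  | cons m ms ih =>
    by_contra h
    rw [List.mem_cons, not_or] at h
    refine h.2 (ih ?_ hv)
    cases m with
    | toBlue w =>
      have : v ≠ w := by rintro rfl; simp at h
      simp [applyMove_toBlue, this, hc]
    | toRed w => simp [applyMove_toRed, hc, ite_eq_iff]
    | compute w => simp [applyMove_compute, hc, ite_eq_iff]
    | delete w => simp [applyMove_delete, hc]

/-- A node that turns red without being computed is the subject of a blue-to-red transfer. -/
theorem toRed_mem_of_runMoves_eq_red {v : V} {l : List (Move V)} {c : Config V}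
    (hc : c v ≠ some Peb.red) (hl : Move.compute v ∉ l)
    (hv : runMoves c l v = some Peb.red) : Move.toRed v ∈ l := by
  induction l generalizing c with
  | nil => exact absurd hv hc
  | cons m ms ih =>
    rw [List.mem_cons, not_or] at hl
    by_contra h
    rw [List.mem_cons, not_or] at h
    refine h.2 (ih ?_ hl.2 hv)
    cases m with
    | toRed w =>
      have : v ≠ w := by rintro rfl; simp at h
      simp [applyMove_toRed, this, hc]
    | compute w =>
      have : v ≠ w := by rintro rfl; simp at hl
      simp [applyMove_compute, this, hc]
    | toBlue w => simp [applyMove_toBlue, hc, ite_eq_iff]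
    | delete w => simp [applyMove_delete, hc]

/-- In a oneshot pebbling, a node that is red, later not red, and later red again is
transferred in both directions. -/
theorem transfers_mem_of_red_notRed_red [Fintype V] {edge : V → V → Prop} {R : ℕ}
    {v : V} {moves p₁ p₂ p₃ : List (Move V)} (hvalid : ValidFrom edge R initConfig moves)
    (hone : Oneshot moves) (h₁₂ : p₁ <+: p₂) (h₂₃ : p₂ <+: p₃) (h₃ : p₃ <+: moves)
    (hv₁ : runMoves initConfig p₁ v = some Peb.red)
    (hv₂ : runMoves initConfig p₂ v ≠ some Peb.red)
    (hv₃ : runMoves initConfig p₃ v = some Peb.red) :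
    Move.toBlue v ∈ moves ∧ Move.toRed v ∈ moves := by
  obtain ⟨s₂, rfl⟩ := h₁₂
  obtain ⟨s₃, rfl⟩ := h₂₃
  obtain ⟨s₄, rfl⟩ := h₃
  simp only [List.append_assoc, validFrom_append] at hvalid
  have hcomp : Move.compute v ∈ p₁ := by
    by_contra h
    rw [runMoves_eq_none hvalid.1 rfl h] at hv₁
    cases hv₁
  have hcount := hone v
  have hpos := List.count_pos_iff.2 hcomp
  simp only [List.count_append] at hcount
  have hs₃ : Move.compute v ∉ s₃ := List.count_eq_zero.1 (by omega)
  rw [runMoves_append] at hv₃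
  have hblue : runMoves initConfig (p₁ ++ s₂) v = some Peb.blue := by
    cases hc : runMoves initConfig (p₁ ++ s₂) v with
    | none =>
      rw [runMoves_eq_none (by simpa only [runMoves_append] using hvalid.2.2.1) hc hs₃] at hv₃
      cases hv₃
    | some x =>
      cases x with
      | red => exact absurd hc hv₂
      | blue => rfl
  have hred := toRed_mem_of_runMoves_eq_red hv₂ hs₃ hv₃
  rw [runMoves_append] at hblue
  have := toBlue_mem_of_runMoves_eq_blue (by simp [hv₁]) hblue
  simp [this, hred]

/-- When a node is computed, its in-neighbors are red. -/
theorem red_of_compute_prefix [Fintype V] {edge : V → V → Prop} {R : ℕ} {u v : V}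
    {moves p : List (Move V)} (hvalid : ValidFrom edge R initConfig moves)
    (hp : p ++ [Move.compute v] <+: moves) (huv : edge u v) :
    runMoves initConfig p u = some Peb.red := by
  obtain ⟨s, rfl⟩ := hp
  simp only [validFrom_append, ValidFrom] at hvalid
  exact hvalid.1.2.1 u huv

/-- Right after a node is computed, the node itself is red. -/
theorem runMoves_compute_self (c : Config V) (p : List (Move V)) (v : V) :
    runMoves c (p ++ [Move.compute v]) v = some Peb.red := by
  simp [runMoves_append, runMoves, applyMove_compute]

/-- Red nodes stay red when a node is computed. -/
theorem runMoves_compute_of_red {c : Config V} {p : List (Move V)} (v : V) {u : V}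
    (hu : runMoves c p u = some Peb.red) :
    runMoves c (p ++ [Move.compute v]) u = some Peb.red := by
  simp [runMoves_append, runMoves, applyMove_compute, hu]

/-- A node carrying a pebble has been computed. -/
theorem exists_compute_prefix [Fintype V] {edge : V → V → Prop} {R : ℕ} {v : V}
    {p : List (Move V)} (hvalid : ValidFrom edge R initConfig p)
    (hv : runMoves initConfig p v ≠ none) :
    ∃ q, q ++ [Move.compute v] <+: p := by
  have hmem : Move.compute v ∈ p := by
    by_contra h
    exact hv (runMoves_eq_none hvalid rfl h)
  obtain ⟨q, s, rfl⟩ := List.append_of_mem hmem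
  exact ⟨q, s, by simp⟩

theorem ValidFrom.of_prefix [Fintype V] {edge : V → V → Prop} {R : ℕ} {c : Config V}
    {p moves : List (Move V)} (hvalid : ValidFrom edge R c moves) (hp : p <+: moves) :
    ValidFrom edge R c p := by
  obtain ⟨s, rfl⟩ := hp
  exact ((validFrom_append _ _ _).1 hvalid).1

/-- After computing a node, at most `R` nodes are red. -/
theorem redCount_le_of_compute_prefix [Fintype V] {edge : V → V → Prop} {R : ℕ} {v : V}
    {moves p : List (Move V)} (hvalid : ValidFrom edge R initConfig moves)
    (hp : p ++ [Move.compute v] <+: moves) :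
    redCount (runMoves initConfig (p ++ [Move.compute v])) ≤ R := by
  have := hvalid.of_prefix hp
  simp only [validFrom_append, ValidFrom] at this
  simpa only [runMoves_append, runMoves] using this.2.2.1

end Runs

theorem card_le_redCount [Fintype V] {ι : Type*} [Fintype ι] {c : Config V} (f : ι → V)
    (hf : Function.Injective f) (hred : ∀ i, c (f i) = some Peb.red) :
    Fintype.card ι ≤ redCount c := by
  rw [← Finset.card_univ]
  exact Finset.card_le_card_of_injOn f (by simp [hred]) hf.injOn

section VertexCoverDag

variable {N k : ℕ} {adj : Fin N → Fin N → Prop}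

/-- The second-level target of `a` is a sink. -/
theorem isSink_secondTarget (a : Fin N) :
    IsSink (vcEdge N k adj) (Sum.inr (Sum.inr (Sum.inl a))) := by
  intro u
  rcases u with u | u | u | u | u <;> simp [vcEdge, inGroup1, inGroup2]

/-- The input group `V_{a,2}`, the target `t_{a,2}` and a common node of another vertex
cannot be simultaneously red. -/
theorem common_not_red_of_group2_red (hk : N < k) (hirr : ∀ x, ¬ adj x x)
    {c : Config (VCNode N k adj)} [Fintype (VCNode N k adj)] (hcard : redCount c ≤ k + 1)
    {a b : Fin N} (hab : a ≠ b) (j : Fin (k - N))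
    (hgroup : ∀ u, inGroup2 a u → c u = some Peb.red)
    (htarget : c (Sum.inr (Sum.inr (Sum.inl a))) = some Peb.red) :
    c (Sum.inl (b, j)) ≠ some Peb.red := by
  intro hb
  let f : Fin (k - N) ⊕ (Fin N ⊕ Bool) → VCNode N k adj
    | Sum.inl i => Sum.inl (a, i)
    | Sum.inr (Sum.inl x) =>
        if h : adj a x then Sum.inr (Sum.inl ⟨(x, a), fun e => hirr a (by simp_all)⟩)
        else Sum.inr (Sum.inr (Sum.inr (Sum.inr ⟨(a, x), h⟩)))
    | Sum.inr (Sum.inr true) => Sum.inr (Sum.inr (Sum.inl a))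
    | Sum.inr (Sum.inr false) => Sum.inl (b, j)
  have hf : Function.Injective f := by
    clear hgroup htarget hb hcard
    rintro (i | x | _ | _) (i' | x' | _ | _) h <;> simp only [f] at h <;>
      (try split_ifs at h) <;> simp_all
  have hred : ∀ i, c (f i) = some Peb.red := by
    rintro (i | x | _ | _)
    · exact hgroup _ rfl
    · by_cases h : adj a x
      · simpa [f, h] using hgroup (Sum.inr (Sum.inl ⟨(x, a), fun e => hirr a (by simp_all)⟩))
          ⟨rfl, h⟩
      · simpa [f, h] using hgroup (Sum.inr (Sum.inr (Sum.inr (Sum.inr ⟨(a, x), h⟩)))) rfl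
    · exact hb
    · exact htarget
  have := card_le_redCount f hf hred
  simp only [Fintype.card_sum, Fintype.card_fin, Fintype.card_bool] at this
  omega

/-- Transferring all common nodes of each vertex of `S` in both directions costs at least
`2 * (k - N)` per vertex. -/
theorem two_mul_card_le_cost {moves : List (Move (VCNode N k adj))} (S : Finset (Fin N))
    (hS : ∀ b ∈ S, ∀ j : Fin (k - N),
      Move.toBlue (Sum.inl (b, j)) ∈ moves ∧ Move.toRed (Sum.inl (b, j)) ∈ moves) :
    2 * (k - N) * S.card ≤ cost moves := by
  let f : Bool × Fin (k - N) × Fin N → Move (VCNode N k adj) := fun x =>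
    if x.1 then Move.toBlue (Sum.inl (x.2.2, x.2.1)) else Move.toRed (Sum.inl (x.2.2, x.2.1))
  have hmaps : ∀ x ∈ (Finset.univ : Finset Bool) ×ˢ ((Finset.univ : Finset (Fin (k - N))) ×ˢ S),
      f x ∈ (moves.filter isTransfer).toFinset := by
    rintro ⟨_ | _, j, b⟩ hx <;>
      simp only [Finset.mem_product, Finset.mem_univ, true_and] at hx <;>
      rw [List.mem_toFinset, List.mem_filter]
    · exact ⟨(hS b hx j).2, rfl⟩
    · exact ⟨(hS b hx j).1, rfl⟩
  have hinj : Function.Injective f := by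
    rintro ⟨_ | _, j, b⟩ ⟨_ | _, j', b'⟩ h <;> simp_all [f]
  have := Finset.card_le_card_of_injOn f hmaps hinj.injOn
  simp only [Finset.card_product, Finset.card_univ, Fintype.card_bool, Fintype.card_fin] at this
  calc 2 * (k - N) * S.card = 2 * ((k - N) * S.card) := mul_assoc _ _ _
    _ ≤ _ := this
    _ ≤ cost moves := List.toFinset_card_le _

end VertexCoverDag

/-- For an undirected graph `G` on `N` vertices and `k > N`,
every valid pebbling of the vertex-cover DAG `P(G,k)` with `R = k + 1` red
pebbles in the oneshot model has cost at least `2·(k − N)·τ(G)`. -/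
theorem vertex_cover_dag_cost_lower_bound
    (N k : ℕ) (hk : N < k) (adj : Fin N → Fin N → Prop) [DecidableRel adj]
    (hsymm : Symmetric adj) (hirr : Irreflexive adj)
    (moves : List (Move (VCNode N k adj)))
    (hpeb : IsPebbling (vcEdge N k adj) (k + 1) moves)
    (hone : Oneshot moves) :
    2 * (k - N) * vcNumber adj ≤ cost moves := by
  have hvalid := hpeb.1
  choose p hp using fun a : Fin N =>
    exists_compute_prefix hvalid (hpeb.2 _ (isSink_secondTarget a))
  have hp' : ∀ a, p a <+: moves := fun a => (List.prefix_append _ _).trans (hp a)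
  let S : Finset (Fin N) := Finset.univ.filter fun b =>
    ∃ a, adj a b ∧ p a ++ [Move.compute (Sum.inr (Sum.inr (Sum.inl a)))] <+: p b
  have hcover : IsVertexCover adj S := by
    have key : ∀ a b, adj a b → (p a).length < (p b).length → b ∈ S := by
      intro a b hab hlt
      refine Finset.mem_filter.2 ⟨Finset.mem_univ _, a, hab, ?_⟩
      exact List.prefix_of_prefix_length_le (hp a) (hp' b) (by simpa using hlt)
    intro a b hab
    rcases lt_trichotomy (p a).length (p b).length with h | h | h
    · exact Or.inr (key a b hab h)
    · exfalso
      have := (List.prefix_of_prefix_length_le (hp a) (hp b) (by simp [h])).eq_of_length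
        (by simp [h])
      have hmove := List.append_inj_right' this rfl
      simp only [List.cons.injEq, Move.compute.injEq, Sum.inr.injEq, Sum.inl.injEq, and_true]
        at hmove
      exact hirr a (by simpa [hmove] using hab)
    · exact Or.inl (key b a (hsymm hab) h)
  have htau : vcNumber adj ≤ S.card := Nat.sInf_le ⟨S, hcover, rfl⟩
  refine (Nat.mul_le_mul_left _ htau).trans (two_mul_card_le_cost S ?_)
  intro b hb j
  obtain ⟨a, hab, hpre⟩ := (Finset.mem_filter.1 hb).2
  have hne : a ≠ b := by rintro rfl; exact hirr a hab
  have hgroup : ∀ u, inGroup2 a u → runMoves initConfig (p a) u = some Peb.red :=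
    fun u hu => red_of_compute_prefix hvalid (hp a) hu
  have hfirst := hgroup (Sum.inr (Sum.inl ⟨(b, a), hne.symm⟩)) ⟨rfl, hab⟩
  obtain ⟨q, hq⟩ := exists_compute_prefix (hvalid.of_prefix (hp' a)) (by rw [hfirst]; simp)
  refine transfers_mem_of_red_notRed_red hvalid hone
    (((List.prefix_append q _).trans hq).trans (List.prefix_append _ _)) hpre (hp' b) ?_ ?_ ?_
  · exact red_of_compute_prefix hvalid (hq.trans (hp' a)) rfl
  · exact common_not_red_of_group2_red hk hirr (redCount_le_of_compute_prefix hvalid (hp a)) hne j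
      (fun u hu => runMoves_compute_of_red _ (hgroup u hu)) (runMoves_compute_self _ _ _)
  · exact red_of_compute_prefix hvalid (hp b) rfl

end RBPebble
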